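/- Assume f : ℝⁿ → ℝ is differentiable, μ-strongly convex and L-smooth, g is convex, proper, lower semicontinuous, γ ∈ (0, 2/(μ+L)], and x* minimizes f + g over ℝⁿ. Let R be an integrable random orthogonal projection with average projection 𝖯 = E[R], assume 𝖯 is positive definite with inverse square root Q = 𝖯^{-1/2} and eigenvalue lower bound λ > 0, and set z* = Q(x* − γ∇f(x*)). For any z ∈ ℝⁿ, let x be the proximal point prox_{γg}(Q⁻¹z) and y = Q(x − γ∇f(x)). Then the projected update satisfies the one-step contraction E[‖z − z* + R(y − z)‖²] ≤ (1 − λ · 2γμL/(μ+L)) · ‖z − z*‖². -/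

import Mathlib

open MeasureTheory
open scoped RealInnerProductSpace

lemma aux_deriv_nonneg (ψ : ℝ → ℝ) (c : ℝ) (h : HasDerivAt ψ c 0)
    (hmin : ∀ t, 0 < t → t < 1 → ψ 0 ≤ ψ t) : 0 ≤ c := by
  have h1 := (hasDerivAt_iff_tendsto_slope.1 h).mono_left
    (nhdsWithin_mono (0 : ℝ) (fun t (ht : t ∈ Set.Ioi (0 : ℝ)) => (ne_of_gt ht : t ≠ 0)))
  refine ge_of_tendsto h1 ?_
  filter_upwards [Ioo_mem_nhdsGT (show (0 : ℝ) < 1 by norm_num)] with t ht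
  rw [slope_def_field]
  exact div_nonneg (sub_nonneg.2 (hmin t ht.1 ht.2)) (by linarith [ht.1])

section
variable {E : Type*} [NormedAddCommGroup E] [InnerProductSpace ℝ E] [CompleteSpace E]

lemma aux_line (f : E → ℝ) (f' : E) (x v : E) (t : ℝ) (h : HasGradientAt f f' (x + t • v)) :
    HasDerivAt (fun s : ℝ => f (x + s • v)) ⟪f', v⟫ t := by
  have h1 : HasDerivAt (fun s : ℝ => x + s • v) v t := by
    simpa using ((hasDerivAt_id t).smul_const v).const_add x
  have h2 := (hasGradientAt_iff_hasFDerivAt.1 h).comp_hasDerivAt t h1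
  have e : (InnerProductSpace.toDual ℝ E f') v = ⟪f', v⟫ := by simp
  rw [← e]
  exact h2

lemma aux_line0 (f : E → ℝ) (f' : E) (x v : E) (h : HasGradientAt f f' x) :
    HasDerivAt (fun s : ℝ => f (x + s • v)) ⟪f', v⟫ 0 :=
  aux_line f f' x v 0 (by simpa using h)

lemma aux_norm_sq (u p : E) (c : ℝ) :
    HasGradientAt (fun v : E => c * ‖v - u‖ ^ 2) ((2 * c) • (p - u)) p := by
  rw [hasGradientAt_iff_hasFDerivAt]
  have h := (((hasFDerivAt_id p).sub_const u).norm_sq).const_mul c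
  refine h.congr_fderiv ?_
  ext w
  simp
  ring

lemma aux_opt (h : E → ℝ) (h' p v : E) (gp gv : ℝ) (g : E → EReal)
    (hg_conv : ∀ x y : E, ∀ a b : ℝ, 0 ≤ a → 0 ≤ b → a + b = 1 →
      g (a • x + b • y) ≤ (a : EReal) * g x + (b : EReal) * g y)
    (hh : HasGradientAt h h' p)
    (hmin : ∀ w, (h p : EReal) + g p ≤ (h w : EReal) + g w)
    (hp : g p = gp) (hv : g v = gv) : 0 ≤ ⟪h', v - p⟫ + gv - gp := by
  have hd : HasDerivAt (fun t : ℝ => h (p + t • (v - p)) + t * (gv - gp))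
      (⟪h', v - p⟫ + 1 * (gv - gp)) 0 :=
    (aux_line0 h h' p (v - p) hh).add ((hasDerivAt_id (0 : ℝ)).mul_const (gv - gp))
  have := aux_deriv_nonneg _ _ hd (by
    intro t ht ht1
    have h1 := hg_conv p v (1 - t) t (by linarith) ht.le (by ring)
    have h2 := hmin (p + t • (v - p))
    have e : (1 - t) • p + t • v = p + t • (v - p) := by module
    rw [e, hp, hv] at h1
    have h3 := h2.trans (add_le_add_right h1 _)
    rw [hp] at h3
    have h4 : h p + gp ≤ h (p + t • (v - p)) + ((1 - t) * gp + t * gv) := by exact_mod_cast h3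
    simp only [zero_smul, add_zero, zero_mul]
    linarith)
  linarith

lemma aux_convex (f : E → ℝ) (f' x y : E) (m : ℝ) (h : HasGradientAt f f' x)
    (hsc : StrongConvexOn Set.univ m f) :
    f x + ⟪f', y - x⟫ + m / 2 * ‖y - x‖ ^ 2 ≤ f y := by
  have hd : HasDerivAt (fun t : ℝ => t * (f y - f x) - (t - t ^ 2) * (m / 2 * ‖y - x‖ ^ 2)
      - f (x + t • (y - x)))
      (1 * (f y - f x) - (1 - (2 : ℕ) * 0 ^ (2 - 1)) * (m / 2 * ‖y - x‖ ^ 2) - ⟪f', y - x⟫) 0 :=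
    (((hasDerivAt_id (0 : ℝ)).mul_const _).sub
      (((hasDerivAt_id (0 : ℝ)).sub (hasDerivAt_pow 2 (0 : ℝ))).mul_const _)).sub
      (aux_line0 f f' x (y - x) h)
  have := aux_deriv_nonneg _ _ hd (by
    intro t ht ht1
    have h1 := hsc.2 (Set.mem_univ x) (Set.mem_univ y) (show 0 ≤ 1 - t by linarith) ht.le (by ring)
    have e : (1 - t) • x + t • y = x + t • (y - x) := by module
    rw [e] at h1
    simp only [smul_eq_mul] at h1
    rw [norm_sub_rev x y] at h1
    simp only [zero_smul, add_zero]
    linarith)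
  norm_num at this
  linarith

lemma aux_descent (f : E → ℝ) (f' : E → E) (L : ℝ) (h : ∀ x, HasGradientAt f (f' x) x)
    (hs : ∀ x y, ‖f' x - f' y‖ ≤ L * ‖x - y‖) (x v : E) :
    f (x + v) ≤ f x + ⟪f' x, v⟫ + L / 2 * ‖v‖ ^ 2 := by
  have hd : ∀ t : ℝ, HasDerivAt (fun t : ℝ => f (x + t • v) - t * ⟪f' x, v⟫
      - t ^ 2 * (L / 2 * ‖v‖ ^ 2))
      (⟪f' (x + t • v), v⟫ - 1 * ⟪f' x, v⟫ - ((2 : ℕ) * t ^ (2 - 1)) * (L / 2 * ‖v‖ ^ 2)) t :=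
    fun t => ((aux_line f _ x v t (h _)).sub ((hasDerivAt_id t).mul_const _)).sub
      ((hasDerivAt_pow 2 t).mul_const _)
  have ha : AntitoneOn (fun t : ℝ => f (x + t • v) - t * ⟪f' x, v⟫
      - t ^ 2 * (L / 2 * ‖v‖ ^ 2)) (Set.Ici 0) := by
    refine antitoneOn_of_deriv_nonpos (convex_Ici 0)
      (fun t _ => (hd t).continuousAt.continuousWithinAt)
      (fun t _ => (hd t).differentiableAt.differentiableWithinAt) ?_
    intro t ht
    rw [interior_Ici] at ht
    rw [(hd t).deriv]
    have h1 := real_inner_le_norm (f' (x + t • v) - f' x) v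
    have h2 := hs (x + t • v) x
    rw [add_sub_cancel_left, norm_smul, Real.norm_eq_abs, abs_of_pos ht] at h2
    have h3 := mul_le_mul_of_nonneg_right h2 (norm_nonneg v)
    rw [inner_sub_left] at h1
    norm_num
    nlinarith
  have := ha (Set.mem_Ici.2 le_rfl) (Set.mem_Ici.2 zero_le_one) zero_le_one
  simp only [zero_smul, add_zero, one_smul] at this
  linarith

lemma aux_coco_half (f : E → ℝ) (f' : E → E) (m L : ℝ) (hmL : m < L)
    (h : ∀ x, HasGradientAt f (f' x) x) (hsc : StrongConvexOn Set.univ m f)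
    (hs : ∀ x y, ‖f' x - f' y‖ ≤ L * ‖x - y‖) (x e : E) :
    f x + ⟪f' x, e⟫ + m / 2 * ‖e‖ ^ 2
      + 1 / (2 * (L - m)) * ‖f' (x + e) - f' x - m • e‖ ^ 2 ≤ f (x + e) := by
  have hK : 0 < L - m := by linarith
  set D := f' (x + e) - f' x - m • e with hD
  set s := 1 / (L - m) with hsdef
  have hsK : s * (L - m) = 1 := by rw [hsdef]; field_simp
  have h1 := aux_convex f (f' x) x (x + (e - s • D)) m (h x) hsc
  have h2 := aux_descent f f' L h hs (x + e) (-(s • D))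
  have e1 : x + e + -(s • D) = x + (e - s • D) := by abel
  have e2 : f' (x + e) = D + f' x + m • e := by rw [hD]; abel
  rw [e1] at h2
  rw [add_sub_cancel_left] at h1
  rw [e2] at h2
  rw [norm_neg, inner_neg_right, norm_smul, mul_pow, Real.norm_eq_abs, sq_abs, inner_smul_right,
    inner_add_left, inner_add_left, inner_smul_left, real_inner_self_eq_norm_sq] at h2
  rw [inner_sub_right, inner_smul_right, norm_sub_sq_real, norm_smul, mul_pow, Real.norm_eq_abs,
    sq_abs, inner_smul_right] at h1
  simp only [conj_trivial] at h2
  have e3 : 1 / (2 * (L - m)) = s / 2 := by rw [hsdef]; field_simp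
  rw [e3]
  have e4 : L * s ^ 2 * ‖D‖ ^ 2 = s * ‖D‖ ^ 2 + m * s ^ 2 * ‖D‖ ^ 2 := by
    linear_combination s * ‖D‖ ^ 2 * hsK
  nlinarith

lemma aux_coco (f : E → ℝ) (f' : E → E) (m L : ℝ) (hm : 0 < m) (hmL : m ≤ L)
    (h : ∀ x, HasGradientAt f (f' x) x) (hsc : StrongConvexOn Set.univ m f)
    (hs : ∀ x y, ‖f' x - f' y‖ ≤ L * ‖x - y‖) (x y : E) :
    ‖f' x - f' y‖ ^ 2 + m * L * ‖x - y‖ ^ 2 ≤ (m + L) * ⟪f' x - f' y, x - y⟫ := by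
  rcases hmL.eq_or_lt with rfl | hlt
  · have h1 := aux_convex f (f' x) x y m (h x) hsc
    have h2 := aux_convex f (f' y) y x m (h y) hsc
    have h3 := pow_le_pow_left₀ (norm_nonneg _) (hs x y) 2
    rw [← neg_sub x y, inner_neg_right, norm_neg] at h1
    rw [inner_sub_left]
    nlinarith
  · have hK : 0 < L - m := by linarith
    have h1 := aux_coco_half f f' m L hlt h hsc hs x (y - x)
    have h2 := aux_coco_half f f' m L hlt h hsc hs y (x - y)
    rw [add_sub_cancel] at h1 h2
    have e1 : f' y - f' x - m • (y - x) = -(f' x - f' y - m • (x - y)) := by module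
    rw [e1, norm_neg, ← neg_sub x y, inner_neg_right, norm_neg] at h1
    have h3 : 1 / (L - m) * ‖f' x - f' y - m • (x - y)‖ ^ 2 ≤
        ⟪f' x - f' y, x - y⟫ - m * ‖x - y‖ ^ 2 := by
      have : 1 / (L - m) = 2 * (1 / (2 * (L - m))) := by field_simp
      rw [this, inner_sub_left]
      linarith
    have h4 := mul_le_mul_of_nonneg_left h3 hK.le
    rw [← mul_assoc, mul_one_div_cancel hK.ne', one_mul, norm_sub_sq_real, inner_smul_right,
      norm_smul, mul_pow, Real.norm_eq_abs, sq_abs] at h4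
    linarith

lemma aux_step (f : E → ℝ) (f' : E → E) (m L γ : ℝ) (hm : 0 < m) (hmL : m ≤ L)
    (h : ∀ x, HasGradientAt f (f' x) x) (hsc : StrongConvexOn Set.univ m f)
    (hs : ∀ x y, ‖f' x - f' y‖ ≤ L * ‖x - y‖) (hγ0 : 0 < γ) (hγ : γ ≤ 2 / (m + L)) (x y : E) :
    ‖(x - γ • f' x) - (y - γ • f' y)‖ ^ 2 ≤ (1 - 2 * γ * m * L / (m + L)) * ‖x - y‖ ^ 2 := by
  have hp : 0 < m + L := by linarith
  have h1 := aux_coco f f' m L hm hmL h hsc hs x y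
  have e : (x - γ • f' x) - (y - γ • f' y) = (x - y) - γ • (f' x - f' y) := by module
  rw [e, norm_sub_sq_real, inner_smul_right, norm_smul, mul_pow, Real.norm_eq_abs, sq_abs,
    real_inner_comm]
  rw [le_div_iff₀ hp] at hγ
  have e2 : (1 - 2 * γ * m * L / (m + L)) * ‖x - y‖ ^ 2 =
    ((m + L) * ‖x - y‖ ^ 2 - 2 * γ * m * L * ‖x - y‖ ^ 2) / (m + L) := by field_simp
  rw [e2, le_div_iff₀ hp]
  have h2 := mul_le_mul_of_nonneg_left h1 hγ0.le
  have h3 := mul_le_mul_of_nonneg_right hγ (mul_nonneg hγ0.le (sq_nonneg ‖f' x - f' y‖))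
  linarith

lemma aux_prox (f : E → ℝ) (f' : E) (g : E → EReal) (γ : ℝ) (hγ : 0 < γ) (x xs u : E)
    (h : HasGradientAt f f' xs)
    (hg_conv : ∀ x y : E, ∀ a b : ℝ, 0 ≤ a → 0 ≤ b → a + b = 1 →
      g (a • x + b • y) ≤ (a : EReal) * g x + (b : EReal) * g y)
    (hg_ne_bot : ∀ x, g x ≠ ⊥) (hg_proper : ∃ x, g x ≠ ⊤)
    (hstar : IsMinOn (fun v => (f v : EReal) + g v) Set.univ xs)
    (hx : IsMinOn (fun v => g v + ((‖v - u‖ ^ 2 / (2 * γ) : ℝ) : EReal)) Set.univ x) :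
    ‖x - xs‖ ^ 2 ≤ ‖u - (xs - γ • f')‖ ^ 2 := by
  have fin : ∀ (k : E → ℝ) (p : E), (∀ w, (k p : EReal) + g p ≤ (k w : EReal) + g w) →
      ∃ r : ℝ, g p = r := by
    intro k p hk
    obtain ⟨w, hw⟩ := hg_proper
    have h1 := hk w
    lift g w to ℝ using ⟨hw, hg_ne_bot w⟩ with a ha
    have : g p ≠ ⊤ := by
      intro ht
      rw [ht, EReal.coe_add_top, top_le_iff] at h1
      exact EReal.coe_ne_top (k w + a) (by exact_mod_cast h1)
    exact ⟨_, (EReal.coe_toReal this (hg_ne_bot p)).symm⟩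
  have m1 : ∀ w, (f xs : EReal) + g xs ≤ (f w : EReal) + g w :=
    fun w => isMinOn_iff.1 hstar w (Set.mem_univ w)
  have m2 : ∀ w, ((1 / (2 * γ) * ‖x - u‖ ^ 2 : ℝ) : EReal) + g x ≤
      ((1 / (2 * γ) * ‖w - u‖ ^ 2 : ℝ) : EReal) + g w := by
    intro w
    have := isMinOn_iff.1 hx w (Set.mem_univ w)
    rw [add_comm, add_comm (g w)] at this
    rw [one_div_mul_eq_div, one_div_mul_eq_div]
    exact this
  obtain ⟨a, ha⟩ := fin f xs m1
  obtain ⟨b, hb⟩ := fin (fun w => 1 / (2 * γ) * ‖w - u‖ ^ 2) x m2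
  have o1 := aux_opt f f' xs x a b g hg_conv h m1 ha hb
  have o2 := aux_opt (fun w => 1 / (2 * γ) * ‖w - u‖ ^ 2) _ x xs b a g hg_conv
    (aux_norm_sq u x _) m2 hb ha
  have e : 2 * (1 / (2 * γ)) = γ⁻¹ := by field_simp
  rw [e, inner_smul_left] at o2
  simp only [conj_trivial] at o2
  have o3 : 0 ≤ γ * (⟪f', x - xs⟫ + γ⁻¹ * ⟪x - u, xs - x⟫) :=
    mul_nonneg hγ.le (by linarith)
  rw [mul_add, ← mul_assoc γ γ⁻¹, mul_inv_cancel₀ hγ.ne', one_mul] at o3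
  have e2 : ⟪u - (xs - γ • f'), x - xs⟫ =
      ‖x - xs‖ ^ 2 + (γ * ⟪f', x - xs⟫ + ⟪x - u, xs - x⟫) := by
    rw [← real_inner_self_eq_norm_sq, ← neg_sub x xs, inner_neg_right,
      show u - (xs - γ • f') = (x - xs) + γ • f' - (x - u) by abel,
      inner_sub_left, inner_add_left, inner_smul_left]
    simp only [conj_trivial]
    ring
  have h5 := real_inner_le_norm (u - (xs - γ • f')) (x - xs)
  nlinarith [sq_nonneg (‖u - (xs - γ • f')‖ - ‖x - xs‖)]

lemma aux_int {Ω : Type*} [MeasurableSpace Ω] (μ : Measure Ω) [IsProbabilityMeasure μ]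
    (R : Ω → E →L[ℝ] E) (hInt : Integrable R μ)
    (hProj : ∀ᵐ ω ∂μ,
      (∀ u v : E, ⟪R ω u, v⟫ = ⟪u, R ω v⟫) ∧ (∀ u : E, R ω (R ω u) = R ω u)) (d w : E) :
    ∫ ω, ‖d + R ω w‖ ^ 2 ∂μ =
      ‖d‖ ^ 2 - ⟪d, (∫ ω, R ω ∂μ) d⟫ + ⟪d + w, (∫ ω, R ω ∂μ) (d + w)⟫ := by
  have hi : ∀ v : E, Integrable (fun ω => R ω v) μ := fun v => hInt.apply_continuousLinearMap v
  have hin : ∀ u v : E, Integrable (fun ω => ⟪u, R ω v⟫) μ := fun u v => (hi v).const_inner u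
  have key : ∀ u v : E, ∫ ω, ⟪u, R ω v⟫ ∂μ = ⟪u, (∫ ω, R ω ∂μ) v⟫ := by
    intro u v
    rw [integral_inner (hi v), ContinuousLinearMap.integral_apply hInt]
  have : ∀ᵐ ω ∂μ, ‖d + R ω w‖ ^ 2 = (‖d‖ ^ 2 - ⟪d, R ω d⟫) + ⟪d + w, R ω (d + w)⟫ := by
    filter_upwards [hProj] with ω ⟨h1, h2⟩
    have e1 : ‖R ω w‖ ^ 2 = ⟪w, R ω w⟫ := by
      rw [← real_inner_self_eq_norm_sq, h1, h2]
    have e2 : ⟪w, R ω d⟫ = ⟪d, R ω w⟫ := by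
      rw [← h1, real_inner_comm]
    rw [norm_add_sq_real, e1, map_add, inner_add_left, inner_add_right, inner_add_right, e2]
    ring
  have h0 : ∀ v : E, Integrable (fun ω => ‖d‖ ^ 2 - ⟪v, R ω v⟫) μ :=
    fun v => (integrable_const _).sub (hin v v)
  rw [integral_congr_ae this, integral_add (h0 d) (hin _ _),
    integral_sub (integrable_const _) (hin _ _), key, key]
  simp

end

theorem statement4
    {n : ℕ} {Ω : Type*} [MeasurableSpace Ω] (μ : Measure Ω) [IsProbabilityMeasure μ]
    (m L γ lam : ℝ)
    (f : EuclideanSpace ℝ (Fin n) → ℝ)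
    (f' : EuclideanSpace ℝ (Fin n) → EuclideanSpace ℝ (Fin n))
    (g : EuclideanSpace ℝ (Fin n) → EReal)
    (hm : 0 < m) (hmL : m ≤ L)
    (hgrad : ∀ x, HasGradientAt f (f' x) x)
    (hsc : StrongConvexOn Set.univ m f)
    (hsmooth : ∀ x y, ‖f' x - f' y‖ ≤ L * ‖x - y‖)
    (hg_conv : ∀ x y : EuclideanSpace ℝ (Fin n), ∀ a b : ℝ, 0 ≤ a → 0 ≤ b → a + b = 1 →
      g (a • x + b • y) ≤ (a : EReal) * g x + (b : EReal) * g y)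
    (hg_ne_bot : ∀ x, g x ≠ ⊥) (hg_proper : ∃ x, g x ≠ ⊤)
    (hg_lsc : LowerSemicontinuous g)
    (hγ0 : 0 < γ) (hγ : γ ≤ 2 / (m + L))
    (xstar : EuclideanSpace ℝ (Fin n))
    (hstar : IsMinOn (fun v => (f v : EReal) + g v) Set.univ xstar)
    (R : Ω → EuclideanSpace ℝ (Fin n) →L[ℝ] EuclideanSpace ℝ (Fin n))
    (hInt : Integrable R μ)
    (hProj : ∀ᵐ ω ∂μ,
      (∀ u v : EuclideanSpace ℝ (Fin n), ⟪R ω u, v⟫ = ⟪u, R ω v⟫) ∧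
      (∀ u : EuclideanSpace ℝ (Fin n), R ω (R ω u) = R ω u))
    (P Q Qinv : EuclideanSpace ℝ (Fin n) →L[ℝ] EuclideanSpace ℝ (Fin n))
    (hP : P = ∫ ω, R ω ∂μ)
    (hPpos : ∀ v, v ≠ 0 → 0 < ⟪v, P v⟫)
    (hQsym : ∀ u v, ⟪Q u, v⟫ = ⟪u, Q v⟫)
    (hQpos : ∀ v, v ≠ 0 → 0 < ⟪v, Q v⟫)
    (hQQP : ∀ v, Q (Q (P v)) = v)
    (hPQQ : ∀ v, P (Q (Q v)) = v)
    (hQinv : ∀ v, Q (Qinv v) = v)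
    (hQinv' : ∀ v, Qinv (Q v) = v)
    (hlam : 0 < lam)
    (hlamP : ∀ v, lam * ‖v‖ ^ 2 ≤ ⟪v, P v⟫)
    (zstar : EuclideanSpace ℝ (Fin n))
    (hzstar : zstar = Q (xstar - γ • f' xstar))
    (z x y : EuclideanSpace ℝ (Fin n))
    (hx : IsMinOn (fun v => g v + ((‖v - Qinv z‖ ^ 2 / (2 * γ) : ℝ) : EReal)) Set.univ x)
    (hy : y = Q (x - γ • f' x)) :
    ∫ ω, ‖z - zstar + R ω (y - z)‖ ^ 2 ∂μ ≤
      (1 - lam * (2 * γ * m * L / (m + L))) * ‖z - zstar‖ ^ 2 := by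
  have hp : 0 < m + L := by linarith
  have hQPQ : ∀ e, ⟪Q e, P (Q e)⟫ = ‖e‖ ^ 2 := by
    intro e
    have h1 := congrArg Qinv (hQQP (Q e))
    rw [hQinv', hQinv'] at h1
    rw [hQsym, h1, real_inner_self_eq_norm_sq]
  have h1 := aux_int μ R hInt hProj (z - zstar) (y - z)
  rw [← hP, show z - zstar + (y - z) = Q ((x - γ • f' x) - (xstar - γ • f' xstar)) by
    rw [map_sub, ← hy, ← hzstar]; abel, hQPQ] at h1
  have h2 := aux_step f f' m L γ hm hmL hgrad hsc hsmooth hγ0 hγ x xstar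
  have h3 := aux_prox f (f' xstar) g γ hγ0 x xstar (Qinv z) (hgrad xstar) hg_conv hg_ne_bot
    hg_proper hstar hx
  have h4 := hQPQ (Qinv z - (xstar - γ • f' xstar))
  rw [map_sub, hQinv, ← hzstar] at h4
  rw [← h4] at h3
  have h5 := hlamP (z - zstar)
  rw [h1]
  set c := 2 * γ * m * L / (m + L) with hc
  have hL : 0 < L := by linarith
  have c0 : 0 ≤ c := by positivity
  have c1 : c ≤ 1 := by
    rw [hc, div_le_one hp]
    rw [le_div_iff₀ hp] at hγ
    have : γ * (m + L) * (2 * m * L) ≤ 2 * (2 * m * L) :=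
      mul_le_mul_of_nonneg_right hγ (by positivity)
    have : (2 * γ * m * L) * (m + L) ≤ (m + L) * (m + L) := by nlinarith [sq_nonneg (m - L)]
    exact le_of_mul_le_mul_right this hp
  have h6 := mul_le_mul_of_nonneg_left h3 (show 0 ≤ 1 - c by linarith)
  have h7 := mul_le_mul_of_nonneg_left h5 c0
  linarith
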